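/- Let d ≥ 2 and let σ : ℝ → ℝ be a Lipschitz function that is not affine, applied componentwise to vectors in ℝ^d. Then the continuous-time ResNet control family 𝓕 = { x ↦ W σ(Ax + b) : W, A ∈ ℝ^{d×d}, b ∈ ℝ^d } possesses the universal approximation property in the L^p sense for every 1 ≤ p < ∞: for every continuous F : ℝ^d → ℝ^d, every compact set K ⊆ ℝ^d and every ε > 0, there exists φ ∈ 𝓐_𝓕 with ‖F − φ‖_{L^p(K)} < ε. -/

import Mathlib

open MeasureTheory

/-- `φ` is the time-`t` flow map of the vector field `f` on `ℝ^d`. -/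
def IsFlowMap {d : ℕ} (f : (Fin d → ℝ) → (Fin d → ℝ)) (t : ℝ)
    (φ : (Fin d → ℝ) → (Fin d → ℝ)) : Prop :=
  ∀ x₀ : Fin d → ℝ, ∃ γ : ℝ → (Fin d → ℝ),
    γ 0 = x₀ ∧ γ t = φ x₀ ∧ ∀ s ∈ Set.Icc (0 : ℝ) t, HasDerivAt γ (f (γ s)) s

/-- The attainable set `𝓐_𝓕`. -/
def Attainable {d : ℕ} (F : Set ((Fin d → ℝ) → (Fin d → ℝ))) :
    Set ((Fin d → ℝ) → (Fin d → ℝ)) :=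
  { φ | ∃ (k : ℕ), 0 < k ∧ ∃ (f : Fin k → ((Fin d → ℝ) → (Fin d → ℝ)))
      (t : Fin k → ℝ) (φs : Fin k → ((Fin d → ℝ) → (Fin d → ℝ))),
      (∀ i, f i ∈ F) ∧ (∀ i, 0 ≤ t i) ∧ (∀ i, IsFlowMap (f i) (t i) (φs i)) ∧
      φ = (List.ofFn φs).foldr (· ∘ ·) id }

/-- The continuous-time ResNet control family. -/
def ResNetFamily (d : ℕ) (σ : ℝ → ℝ) : Set ((Fin d → ℝ) → (Fin d → ℝ)) :=
  { f | ∃ (W A : Matrix (Fin d) (Fin d) ℝ) (b : Fin d → ℝ),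
      f = fun x => W.mulVec (fun i => σ (A.mulVec x i + b i)) }

theorem mem_attainable_iff {d : ℕ} {F : Set ((Fin d → ℝ) → (Fin d → ℝ))}
    {φ : (Fin d → ℝ) → (Fin d → ℝ)} :
    φ ∈ Attainable F ↔ ∃ l : List ((Fin d → ℝ) → (Fin d → ℝ)), l ≠ [] ∧
      (∀ ψ ∈ l, ∃ f ∈ F, ∃ t, 0 ≤ t ∧ IsFlowMap f t ψ) ∧ φ = l.foldr (· ∘ ·) id := by
  constructor
  · rintro ⟨k, hk, f, t, φs, hf, ht, hφ, rfl⟩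
    refine ⟨List.ofFn φs, ?_, ?_, rfl⟩
    · simpa using hk.ne'
    · intro ψ hψ
      obtain ⟨i, rfl⟩ := (List.mem_ofFn' _ _).1 hψ
      exact ⟨f i, hf i, t i, ht i, hφ i⟩
  · rintro ⟨l, hl, hψ, rfl⟩
    choose f hf t ht hφ using fun i : Fin l.length => hψ (l.get i) (List.get_mem l i)
    exact ⟨l.length, List.length_pos_iff.2 hl, f, t, l.get, hf, ht, hφ, by rw [List.ofFn_get]⟩

theorem foldr_comp_append {α : Type*} (l l' : List (α → α)) :
    (l ++ l').foldr (· ∘ ·) id = l.foldr (· ∘ ·) id ∘ l'.foldr (· ∘ ·) id := by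
  induction l with
  | nil => rfl
  | cons a l ih => simp only [List.cons_append, List.foldr_cons, ih, Function.comp_assoc]

theorem attainable_comp {d : ℕ} {F : Set ((Fin d → ℝ) → (Fin d → ℝ))}
    {φ ψ : (Fin d → ℝ) → (Fin d → ℝ)} (hφ : φ ∈ Attainable F) (hψ : ψ ∈ Attainable F) :
    φ ∘ ψ ∈ Attainable F := by
  rw [mem_attainable_iff] at *
  obtain ⟨l, hl, h, rfl⟩ := hφ
  obtain ⟨l', -, h', rfl⟩ := hψ
  refine ⟨l ++ l', by simp [hl], fun χ hχ => ?_, (foldr_comp_append l l').symm⟩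
  exact (List.mem_append.1 hχ).elim (h χ) (h' χ)

theorem attainable_of_isFlowMap {d : ℕ} {F : Set ((Fin d → ℝ) → (Fin d → ℝ))}
    {f φ : (Fin d → ℝ) → (Fin d → ℝ)} {t : ℝ} (hf : f ∈ F) (ht : 0 ≤ t)
    (hφ : IsFlowMap f t φ) : φ ∈ Attainable F :=
  mem_attainable_iff.2 ⟨[φ], by simp, by simpa using ⟨f, hf, t, ht, hφ⟩, rfl⟩

theorem id_mem_attainable {d : ℕ} {σ : ℝ → ℝ} : id ∈ Attainable (ResNetFamily d σ) := by
  refine attainable_of_isFlowMap (f := fun _ => 0) (t := 0) ⟨0, 0, 0, by simp⟩ le_rfl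
    fun x₀ => ⟨fun _ => x₀, rfl, rfl, fun s _ => hasDerivAt_const s x₀⟩

theorem attainable_iterate {d : ℕ} {σ : ℝ → ℝ} {φ : (Fin d → ℝ) → (Fin d → ℝ)}
    (hφ : φ ∈ Attainable (ResNetFamily d σ)) (n : ℕ) :
    φ^[n] ∈ Attainable (ResNetFamily d σ) := by
  induction n with
  | zero => exact id_mem_attainable
  | succ n ih => exact attainable_comp ih hφ

/-- The displacements `v` with values in `D`, invariant under translations by `D`, such that all
maps `x ↦ x + c • v x` are attainable. -/
def shears {d : ℕ} (σ : ℝ → ℝ) (D : Submodule ℝ (Fin d → ℝ)) :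
    Submodule ℝ ((Fin d → ℝ) → (Fin d → ℝ)) where
  carrier := { v | (∀ x, v x ∈ D) ∧ (∀ x, ∀ z ∈ D, v (x + z) = v x) ∧
    ∀ c : ℝ, (fun x => x + c • v x) ∈ Attainable (ResNetFamily d σ) }
  zero_mem' := ⟨fun _ => D.zero_mem, fun _ _ _ => rfl, fun c => by
    simpa using! id_mem_attainable (σ := σ)⟩
  add_mem' := by
    rintro v u ⟨hv, hv', hvA⟩ ⟨hu, hu', huA⟩
    refine ⟨fun x => D.add_mem (hv x) (hu x), fun x z hz => ?_, fun c => ?_⟩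
    · simp only [Pi.add_apply, hv' x z hz, hu' x z hz]
    · convert! attainable_comp (hvA c) (huA c) using 1
      funext x
      simp only [Function.comp_apply, Pi.add_apply, smul_add,
        hv' x _ (D.smul_mem c (hu x))]
      abel
  smul_mem' := by
    rintro a v ⟨hv, hv', hvA⟩
    refine ⟨fun x => D.smul_mem a (hv x), fun x z hz => ?_, fun c => ?_⟩
    · simp only [Pi.smul_apply, hv' x z hz]
    · simpa only [Pi.smul_apply, smul_smul] using! hvA (c * a)

/-- The linear span of the functions `y ↦ σ (a * y + b)`. -/
def ridgeSpan (σ : ℝ → ℝ) : Submodule ℝ (ℝ → ℝ) :=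
  Submodule.span ℝ (Set.range fun q : ℝ × ℝ => fun y => σ (q.1 * y + q.2))

theorem single_neuron_attainable {d : ℕ} {σ : ℝ → ℝ} {i j : Fin d} (hij : i ≠ j) (a b c : ℝ) :
    (fun x : Fin d → ℝ => x + c • Pi.single i (σ (a * x j + b))) ∈
      Attainable (ResNetFamily d σ) := by
  refine attainable_of_isFlowMap (f := fun x => Pi.single i (c * σ (a * x j + b))) (t := 1)
    ⟨Matrix.of fun k l => if k = i ∧ l = i then c else 0,
      Matrix.of fun k l => if l = j then a else 0, fun _ => b, ?_⟩ zero_le_one ?_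
  · funext x k
    by_cases hk : k = i
    · subst hk
      simp [Matrix.mulVec, dotProduct]
    · simp [Matrix.mulVec, dotProduct, hk]
  · intro x
    refine ⟨fun s => x + s • Pi.single i (c * σ (a * x j + b)), by simp, ?_, fun s _ => ?_⟩
    · simp [← Pi.single_smul]
    · have h1 : (x + s • (Pi.single i (c * σ (a * x j + b)) : Fin d → ℝ)) j = x j := by
        simp [hij.symm]
      simp only [h1]
      simpa using ((hasDerivAt_id s).smul_const
        (Pi.single i (c * σ (a * x j + b)) : Fin d → ℝ)).const_add x

theorem single_mem_shears {d : ℕ} {σ : ℝ → ℝ} {D : Submodule ℝ (Fin d → ℝ)} {i j : Fin d}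
    (hi : Pi.single i 1 ∈ D) (hj : ∀ z ∈ D, z j = 0) {h : ℝ → ℝ} (hh : h ∈ ridgeSpan σ) :
    (fun x : Fin d → ℝ => (Pi.single i (h (x j)) : Fin d → ℝ)) ∈ shears σ D := by
  have hij : i ≠ j := by
    rintro rfl
    simpa using hj _ hi
  induction hh using Submodule.span_induction with
  | mem h hh =>
    obtain ⟨⟨a, b⟩, rfl⟩ := hh
    refine ⟨fun x => ?_, fun x z hz => ?_, single_neuron_attainable hij a b⟩
    · simpa [← Pi.single_smul] using D.smul_mem (σ (a * x j + b)) hi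
    · simp [hj z hz]
  | zero =>
    convert! (shears σ D).zero_mem using 1
    funext x
    simp
  | add f g _ _ hf hg =>
    convert! (shears σ D).add_mem hf hg using 1
    funext x
    simp [Pi.single_add]
  | smul c f _ hf =>
    convert! (shears σ D).smul_mem c hf using 1
    funext x
    simp [← Pi.single_smul]

theorem exists_hasDerivAt_ne_zero {σ : ℝ → ℝ} {L : NNReal} (hσ : LipschitzWith L σ)
    (hna : ¬ ∃ a c : ℝ, ∀ x, σ x = a * x + c) : ∃ s m : ℝ, m ≠ 0 ∧ HasDerivAt σ m s := by
  by_contra! h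
  refine hna ⟨0, σ 0, fun x => ?_⟩
  have hae : ∀ᵐ y, HasDerivAt σ 0 y := by
    filter_upwards [hσ.ae_differentiableAt_real] with y hy
    have := hy.hasDerivAt
    by_cases h0 : deriv σ y = 0
    · rwa [h0] at this
    · exact absurd this (h y _ h0)
  obtain ⟨C, hC⟩ := ((hσ.lipschitzOnWith (s := Set.uIcc 0 x)).absolutelyContinuousOnInterval
    ).const_of_ae_hasDerivAt_zero (hae.mono fun y hy _ => hy)
  rw [hC x Set.right_mem_uIcc, hC 0 Set.left_mem_uIcc]
  ring

theorem exists_solution_of_lipschitz {g : ℝ → ℝ} {K : NNReal} (hK : 0 < K)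
    (hg : LipschitzWith K g) (hg0 : g 0 = 0) (x₀ : ℝ) :
    ∃ γ : ℝ → ℝ, γ 0 = x₀ ∧ ∀ s ∈ Set.Icc (0 : ℝ) (1 / (4 * K)), HasDerivAt γ (g (γ s)) s := by
  have hK' : (0 : ℝ) < K := hK
  have hτ : (0 : ℝ) < 1 / (2 * K) := by positivity
  have hpl : IsPicardLindelof (fun _ => g) (tmin := -(1 / (2 * K : ℝ))) (tmax := 1 / (2 * K))
      ⟨0, by constructor <;> linarith⟩ x₀ (‖x₀‖₊ + 1) 0 (K * (2 * ‖x₀‖₊ + 1)) K := by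
    refine IsPicardLindelof.of_time_independent (fun x hx => ?_) hg.lipschitzOnWith ?_
    · have h1 : ‖g x‖ ≤ K * ‖x‖ := by simpa [hg0] using hg.norm_sub_le x 0
      have h2 : ‖x‖ ≤ ‖x₀‖ + (‖x₀‖ + 1) := by
        have := norm_sub_norm_le x x₀
        rw [mem_closedBall_iff_norm] at hx
        push_cast at hx
        linarith [show ((‖x₀‖₊ : NNReal) : ℝ) = ‖x₀‖ from rfl]
      push_cast
      calc ‖g x‖ ≤ K * ‖x‖ := h1
        _ ≤ K * (2 * ‖x₀‖ + 1) := by gcongr; linarith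
    · push_cast
      simp only [sub_zero, sub_neg_eq_add, zero_add, max_self]
      have : (K : ℝ) * (2 * ‖x₀‖ + 1) * (1 / (2 * K)) = ‖x₀‖ + 1 / 2 := by
        field_simp
      rw [this]
      linarith
  obtain ⟨γ, h0, hγ⟩ := hpl.exists_eq_forall_mem_Icc_hasDerivWithinAt₀
  refine ⟨γ, h0, fun s hs => ?_⟩
  have hlt : 1 / (4 * K : ℝ) < 1 / (2 * K) := by
    apply one_div_lt_one_div_of_lt <;> linarith
  have h1 : -(1 / (2 * K : ℝ)) < s := by linarith [hs.1]
  have h2 : s < 1 / (2 * K) := by linarith [hs.2]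
  exact (hγ s ⟨h1.le, h2.le⟩).hasDerivAt (Icc_mem_nhds h1 h2)

theorem abs_le_exp_mul_of_dissipative {g γ : ℝ → ℝ} {K : NNReal} (hK : 0 < K)
    (hg : LipschitzWith K g) (hg0 : g 0 = 0) {c R : ℝ}
    (hdis : ∀ y, |y| ≤ 2 * R → y * g y ≤ -c * y ^ 2)
    (hγ : ∀ s ∈ Set.Icc (0 : ℝ) (1 / (4 * K)), HasDerivAt γ (g (γ s)) s) (h0 : |γ 0| ≤ R) :
    |γ (1 / (4 * K))| ≤ Real.exp (-(c * (1 / (4 * K)))) * |γ 0| := by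
  set T : ℝ := 1 / (4 * K) with hT
  have hK' : (0 : ℝ) < K := hK
  have hT0 : 0 < T := by positivity
  have hcont : ContinuousOn γ (Set.Icc 0 T) := fun s hs => (hγ s hs).continuousAt.continuousWithinAt
  have hbound : ∀ s ∈ Set.Icc (0 : ℝ) T, |γ s| ≤ 2 * R := by
    intro s hs
    have := norm_le_gronwallBound_of_norm_deriv_right_le (f := γ) (f' := fun s => g (γ s))
      (δ := |γ 0|) (K := K) (ε := 0) hcont
      (fun s hs => (hγ s ⟨hs.1, hs.2.le⟩).hasDerivWithinAt) le_rfl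
      (fun s _ => by simpa [hg0] using hg.norm_sub_le (γ s) 0) s hs
    rw [gronwallBound_ε0, sub_zero, Real.norm_eq_abs] at this
    have h1 : (K : ℝ) * s ≤ 1 / 4 := by
      calc (K : ℝ) * s ≤ K * T := by gcongr; exact hs.2
        _ = 1 / 4 := by rw [hT]; field_simp
    have h2 : Real.exp (K * s) ≤ 2 := by
      have h3 : Real.exp (K * s) ≤ 1 / (1 - K * s) := by
        have h5 := Real.one_sub_le_exp_neg (K * s)
        rw [Real.exp_neg] at h5
        rw [le_div_iff₀ (by linarith)]
        have h4 := Real.exp_pos (K * s)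
        calc Real.exp (K * s) * (1 - K * s) ≤ Real.exp (K * s) * (Real.exp (K * s))⁻¹ := by gcongr
          _ = 1 := mul_inv_cancel₀ h4.ne'
      refine h3.trans ?_
      rw [div_le_iff₀ (by linarith)]
      linarith
    calc |γ s| ≤ |γ 0| * Real.exp (K * s) := this
      _ ≤ R * 2 := by gcongr; exact (abs_nonneg _).trans h0
      _ = 2 * R := by ring
  have hder : ∀ s ∈ Set.Icc (0 : ℝ) T, HasDerivAt (fun s => γ s ^ 2 * Real.exp (2 * c * s))
      ((2 * γ s * g (γ s)) * Real.exp (2 * c * s) +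
        γ s ^ 2 * (Real.exp (2 * c * s) * (2 * c))) s := by
    intro s hs
    have h1 := (hγ s hs).pow 2
    have h2 : HasDerivAt (fun s : ℝ => Real.exp (2 * c * s))
        (Real.exp (2 * c * s) * (2 * c)) s := by
      simpa using ((hasDerivAt_id s).const_mul (2 * c)).exp
    convert! h1.mul h2 using 1
    simp
  have hanti : AntitoneOn (fun s => γ s ^ 2 * Real.exp (2 * c * s)) (Set.Icc 0 T) := by
    refine antitoneOn_of_deriv_nonpos (convex_Icc 0 T)
      (fun s hs => (hder s hs).continuousAt.continuousWithinAt)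
      (fun s hs => (hder s (interior_subset hs)).differentiableAt.differentiableWithinAt)
      fun s hs => ?_
    have hs' := interior_subset hs
    rw [(hder s hs').deriv]
    have := hdis (γ s) (hbound s hs')
    have he := Real.exp_pos (2 * c * s)
    nlinarith
  have hfin := hanti (Set.left_mem_Icc.2 hT0.le) (Set.right_mem_Icc.2 hT0.le) hT0.le
  simp only [mul_zero, Real.exp_zero, mul_one] at hfin
  refine abs_le_of_sq_le_sq' ?_ (by positivity) |> abs_le.2
  have he : Real.exp (-(c * T)) ^ 2 * Real.exp (2 * c * T) = 1 := by
    rw [← Real.exp_nat_mul, ← Real.exp_add]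
    norm_num
    ring
  calc γ T ^ 2 = Real.exp (-(c * T)) ^ 2 * (γ T ^ 2 * Real.exp (2 * c * T)) := by
        linear_combination (-γ T ^ 2) * he
    _ ≤ Real.exp (-(c * T)) ^ 2 * γ 0 ^ 2 := by gcongr
    _ = (Real.exp (-(c * T)) * |γ 0|) ^ 2 := by rw [mul_pow, sq_abs]

/-- A vector field contracting all coordinates but the one of index `i`. -/
theorem contracting_field_mem {d : ℕ} (σ : ℝ → ℝ) (i : Fin d) (w a s : ℝ) :
    (fun x : Fin d → ℝ => fun j => if j = i then 0 else w * (σ (a * x j + s) - σ s)) ∈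
      ResNetFamily d σ := by
  refine ⟨Matrix.of fun k l =>
      if k = i then 0 else (if l = k then w else 0) - if l = i then w else 0,
    Matrix.of fun k l => if k = i then 0 else if l = k then a else 0, fun _ => s, ?_⟩
  funext x k
  by_cases hk : k = i
  · simp [Matrix.mulVec, dotProduct, hk]
  · simp [Matrix.mulVec, dotProduct, hk, sub_mul, Finset.sum_sub_distrib, mul_sub]

theorem exists_dissipative_field {σ : ℝ → ℝ} {s m : ℝ} (hm : m ≠ 0) (hs : HasDerivAt σ m s)
    {R : ℝ} (hR : 0 < R) :
    ∃ w a : ℝ, ∀ y, |y| ≤ R → y * (w * (σ (a * y + s) - σ s)) ≤ -(1 / 2) * y ^ 2 := by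
  have hlo := hs.isLittleO
  rw [Asymptotics.isLittleO_iff] at hlo
  have hm' : 0 < |m| := abs_pos.2 hm
  obtain ⟨δ, hδ, h⟩ := Metric.eventually_nhds_iff.1 (hlo (c := |m| / 2) (by positivity))
  set a : ℝ := δ / (2 * R) with ha
  have ha0 : 0 < a := by positivity
  refine ⟨-1 / (a * m), a, fun y hy => ?_⟩
  have hay : |a * y| < δ := by
    rw [abs_mul, abs_of_pos ha0]
    calc a * |y| ≤ a * R := by gcongr
      _ = δ / 2 := by rw [ha]; field_simp
      _ < δ := by linarith
  have h1 := h (y := a * y + s) (by simpa [Real.dist_eq] using hay)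
  simp only [add_sub_cancel_right, smul_eq_mul, Real.norm_eq_abs] at h1
  set e := σ (a * y + s) - σ s - a * y * m with he
  have h2 : y * (-1 / (a * m) * (σ (a * y + s) - σ s)) = -y ^ 2 - y * e / (a * m) := by
    rw [show σ (a * y + s) - σ s = e + a * y * m by rw [he]; ring]
    field_simp
    ring
  have h3 : |y * e / (a * m)| ≤ 1 / 2 * y ^ 2 := by
    rw [abs_div, abs_mul, abs_mul a m, abs_of_pos ha0, div_le_iff₀ (by positivity), ← sq_abs y]
    rw [abs_mul, abs_of_pos ha0] at h1
    calc |y| * |e| ≤ |y| * (|m| / 2 * (a * |y|)) := by gcongr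
      _ = _ := by ring
  rw [h2]
  linarith [neg_abs_le (y * e / (a * m))]

theorem exists_contraction {d : ℕ} {σ : ℝ → ℝ} {L : NNReal} (hσ : LipschitzWith L σ)
    (hna : ¬ ∃ a c : ℝ, ∀ x, σ x = a * x + c) (i : Fin d) {R lam : ℝ} (hR : 0 < R)
    (hlam : 0 < lam) :
    ∃ u : ℝ → ℝ, (∀ y, |y| ≤ R → |u y| ≤ lam) ∧
      (fun x : Fin d → ℝ => fun j => if j = i then x i else u (x j)) ∈
        Attainable (ResNetFamily d σ) := by
  obtain ⟨s, m, hm, hs⟩ := exists_hasDerivAt_ne_zero hσ hna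
  obtain ⟨w, a, hdis⟩ := exists_dissipative_field hm hs (R := 2 * R) (by positivity)
  set g : ℝ → ℝ := fun y => w * (σ (a * y + s) - σ s) with hgdef
  set K : NNReal := ‖w‖₊ * (L * ‖a‖₊) + 1 with hKdef
  have hK : 0 < K := by positivity
  have hg : LipschitzWith K g := by
    refine LipschitzWith.of_dist_le_mul fun x y => ?_
    have h1 := hσ.dist_le_mul (a * x + s) (a * y + s)
    rw [Real.dist_eq] at h1 ⊢
    have h2 : g x - g y = w * (σ (a * x + s) - σ (a * y + s)) := by simp only [hgdef]; ring
    have h3 : dist (a * x + s) (a * y + s) = |a| * dist x y := by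
      rw [Real.dist_eq, Real.dist_eq, ← abs_mul]; ring_nf
    rw [h2, abs_mul]
    rw [h3] at h1
    have h4 : (K : ℝ) = |w| * (L * |a|) + 1 := by simp [hKdef]
    rw [h4]
    calc |w| * |σ (a * x + s) - σ (a * y + s)| ≤ |w| * (L * (|a| * dist x y)) := by gcongr
      _ ≤ (|w| * (L * |a|) + 1) * dist x y := by nlinarith [dist_nonneg (x := x) (y := y)]
  have hg0 : g 0 = 0 := by simp [hgdef]
  choose γ hγ0 hγ using fun x₀ => exists_solution_of_lipschitz hK hg hg0 x₀
  set T : ℝ := 1 / (4 * K) with hT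
  have hT0 : 0 < T := by have : (0 : ℝ) < K := hK; positivity
  set u : ℝ → ℝ := fun y => γ y T with hu
  set ρ : ℝ := Real.exp (-(1 / 2 * T)) with hρ
  have hρ1 : ρ < 1 := by rw [hρ, Real.exp_lt_one_iff]; linarith
  have hρ0 : 0 < ρ := Real.exp_pos _
  have hcontr : ∀ y, |y| ≤ R → |u y| ≤ ρ * |y| := by
    intro y hy
    have := abs_le_exp_mul_of_dissipative hK hg hg0 (c := 1 / 2) (R := R) hdis (hγ y)
      (by rwa [hγ0])
    rwa [hγ0] at this
  have hiter : ∀ (n : ℕ) y, |y| ≤ R → |u^[n] y| ≤ ρ ^ n * |y| := by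
    intro n y hy
    induction n with
    | zero => simp
    | succ n ih =>
      rw [Function.iterate_succ_apply']
      have h1 : |u^[n] y| ≤ R := ih.trans ((mul_le_of_le_one_left (abs_nonneg y)
        (pow_le_one₀ hρ0.le hρ1.le)).trans hy)
      calc |u (u^[n] y)| ≤ ρ * |u^[n] y| := hcontr _ h1
        _ ≤ ρ * (ρ ^ n * |y|) := by gcongr
        _ = ρ ^ (n + 1) * |y| := by ring
  obtain ⟨n, hn⟩ := exists_pow_lt_of_lt_one (show 0 < lam / R by positivity) hρ1
  refine ⟨u^[n], fun y hy => (hiter n y hy).trans ?_, ?_⟩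
  · calc ρ ^ n * |y| ≤ lam / R * R := by gcongr
      _ = lam := by field_simp
  · have hatt : (fun x : Fin d → ℝ => fun j => if j = i then x i else u (x j)) ∈
        Attainable (ResNetFamily d σ) := by
      refine attainable_of_isFlowMap (contracting_field_mem σ i w a s) hT0.le fun x => ?_
      refine ⟨fun t j => if j = i then x i else γ (x j) t, ?_, rfl, fun t ht => ?_⟩
      · funext j
        by_cases hj : j = i
        · simp [hj]
        · simp [hj, hγ0]
      · refine hasDerivAt_pi.2 fun j => ?_
        by_cases hj : j = i
        · simpa [hj] using hasDerivAt_const t (x i)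
        · simpa [hj] using hγ (x j) t ht
    convert! attainable_iterate hatt n using 1
    have : ∀ (n : ℕ) (x : Fin d → ℝ),
        (fun x : Fin d → ℝ => fun j => if j = i then x i else u (x j))^[n] x =
          fun j => if j = i then x i else u^[n] (x j) := by
      intro n
      induction n with
      | zero =>
        intro x
        funext j
        by_cases hj : j = i <;> simp [hj]
      | succ n ih =>
        intro x
        rw [Function.iterate_succ_apply', ih]
        funext j
        by_cases hj : j = i
        · simp [hj]
        · simp only [hj, if_false, Function.iterate_succ_apply']
    exact (funext (this n)).symm

theorem exists_derivative_eq (p : Polynomial ℝ) : ∃ q : Polynomial ℝ, q.derivative = p := by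
  induction p using Polynomial.induction_on' with
  | add p q hp hq =>
    obtain ⟨p', rfl⟩ := hp
    obtain ⟨q', rfl⟩ := hq
    exact ⟨p' + q', Polynomial.derivative_add⟩
  | monomial n a =>
    refine ⟨Polynomial.monomial (n + 1) (a / (n + 1)), ?_⟩
    rw [Polynomial.derivative_monomial]
    push_cast
    rw [div_mul_cancel₀ a (by positivity)]

theorem exists_polynomial_of_iteratedDeriv_eq_zero (k : ℕ) :
    ∀ f : ℝ → ℝ, ContDiff ℝ (⊤ : ℕ∞) f → (∀ x, iteratedDeriv k f x = 0) →
      ∃ p : Polynomial ℝ, ∀ x, f x = p.eval x := by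
  induction k with
  | zero => exact fun f _ h => ⟨0, by simpa using h⟩
  | succ k ih =>
    intro f hf h
    obtain ⟨p, hp⟩ := ih (deriv f) (contDiff_infty_iff_deriv.1 hf).2
      (fun x => by rw [← iteratedDeriv_succ']; exact h x)
    obtain ⟨q, rfl⟩ := exists_derivative_eq p
    have hd : Differentiable ℝ f := hf.differentiable (by simp)
    have hconst : ∀ x, f x - q.eval x = f 0 - q.eval 0 := fun x =>
      is_const_of_deriv_eq_zero (f := fun x => f x - q.eval x) (hd.sub q.differentiable)
        (fun y => by
          rw [deriv_fun_sub (hd y) q.differentiableAt, hp y, Polynomial.deriv, sub_self]) x 0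
    refine ⟨q + Polynomial.C (f 0 - q.eval 0), fun x => ?_⟩
    rw [Polynomial.eval_add, Polynomial.eval_C, ← hconst x]
    ring

/-- A smooth Lipschitz function one of whose higher derivatives vanishes identically is affine. -/
theorem affine_of_lipschitz_of_iteratedDeriv_eq_zero {f : ℝ → ℝ} {L : NNReal}
    (hL : LipschitzWith L f) (hf : ContDiff ℝ (⊤ : ℕ∞) f) {k : ℕ}
    (h : ∀ x, iteratedDeriv k f x = 0) : ∃ a c : ℝ, ∀ x, f x = a * x + c := by
  obtain ⟨p, hp⟩ := exists_polynomial_of_iteratedDeriv_eq_zero k f hf h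
  have hfp : f = fun x => p.eval x := funext hp
  have hbdd : Filter.IsBoundedUnder (· ≤ ·) Filter.atTop fun x => |p.derivative.eval x| := by
    refine Filter.isBoundedUnder_of ⟨L, fun x => ?_⟩
    rw [← Polynomial.deriv, ← hfp, ← Real.norm_eq_abs]
    exact norm_deriv_le_of_lipschitz hL
  rw [Polynomial.isBoundedUnder_abs_atTop_iff] at hbdd
  obtain ⟨a, ha⟩ : ∃ a, p.derivative = Polynomial.C a := ⟨_, Polynomial.eq_C_of_degree_le_zero hbdd⟩
  refine ⟨a, p.eval 0, fun x => ?_⟩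
  have hconst := is_const_of_deriv_eq_zero (f := fun x => p.eval x - a * x)
    (by fun_prop) (fun y => by
      rw [deriv_fun_sub p.differentiableAt (by fun_prop), Polynomial.deriv, ha]
      simp) x 0
  simp only [mul_zero, sub_zero] at hconst
  rw [hp x]
  linarith

/-- `x ↦ x ^ k * f (a * x + b)` as a continuous function on `[-R, R]`. -/
def monoRidge (R : ℝ) (k : ℕ) (f : C(ℝ, ℝ)) (a b : ℝ) : C(Set.Icc (-R) R, ℝ) where
  toFun x := (x : ℝ) ^ k * f (a * x + b)

theorem continuous_monoRidge (R : ℝ) (k : ℕ) (f : C(ℝ, ℝ)) {α : Type*} [TopologicalSpace α]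
    {a b : α → ℝ} (ha : Continuous a) (hb : Continuous b) :
    Continuous fun t => monoRidge R k f (a t) (b t) := by
  refine ContinuousMap.continuous_of_continuous_uncurry _ ?_
  change Continuous fun q : α × Set.Icc (-R) R => (q.2 : ℝ) ^ k * f (a q.1 * q.2 + b q.1)
  fun_prop

theorem hasDerivAt_monoRidge (R : ℝ) (k : ℕ) {f f' : C(ℝ, ℝ)} (hf : ∀ x, HasDerivAt f (f' x) x)
    (a b : ℝ) : HasDerivAt (fun a => monoRidge R k f a b) (monoRidge R (k + 1) f' a b) a := by
  have hcont : Continuous fun s => monoRidge R (k + 1) f' s b :=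
    continuous_monoRidge R (k + 1) f' continuous_id continuous_const
  have hFTC := intervalIntegral.integral_hasDerivAt_right (hcont.intervalIntegrable 0 a)
    (hcont.stronglyMeasurableAtFilter _ _) hcont.continuousAt
  have heq : (fun a => monoRidge R k f a b) =
      fun a => (∫ s in (0 : ℝ)..a, monoRidge R (k + 1) f' s b) + monoRidge R k f 0 b := by
    funext t
    ext x
    have h1 : (∫ s in (0 : ℝ)..t, monoRidge R (k + 1) f' s b) x =
        ∫ s in (0 : ℝ)..t, monoRidge R (k + 1) f' s b x :=
      ((ContinuousMap.evalCLM ℝ x).intervalIntegral_comp_comm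
        (hcont.intervalIntegrable 0 t)).symm
    have h2 : ∀ s, HasDerivAt (fun s => monoRidge R k f s b x)
        (monoRidge R (k + 1) f' s b x) s := by
      intro s
      have h3 : HasDerivAt (fun s : ℝ => s * (x : ℝ) + b) x s := by
        simpa using ((hasDerivAt_id s).mul_const (x : ℝ)).add_const b
      convert! ((hf (s * x + b)).comp s h3).const_mul ((x : ℝ) ^ k) using 1
      change (x : ℝ) ^ (k + 1) * f' (s * x + b) = _
      ring
    have h4 := intervalIntegral.integral_eq_sub_of_hasDerivAt (a := 0) (b := t) (fun s _ => h2 s)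
      (((ContinuousMap.evalCLM ℝ x).continuous.comp hcont).intervalIntegrable 0 t)
    rw [ContinuousMap.add_apply, h1, h4]
    ring
  rw [heq]
  exact hFTC.add_const _

/-- The closed linear span of the functions `x ↦ σ (a * x + b)` in `C([-R, R])`. -/
noncomputable def ridgeClosure (R : ℝ) (σ : C(ℝ, ℝ)) : Submodule ℝ C(Set.Icc (-R) R, ℝ) :=
  (Submodule.span ℝ (Set.range fun q : ℝ × ℝ => monoRidge R 0 σ q.1 q.2)).topologicalClosure

theorem hasDerivAt_mem_of_isClosed {E : Type*} [NormedAddCommGroup E] [NormedSpace ℝ E]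
    {S : Submodule ℝ E} (hS : IsClosed (S : Set E)) {v : ℝ → E} (hv : ∀ t, v t ∈ S) {v' : E}
    {t : ℝ} (h : HasDerivAt v v' t) : v' ∈ S := by
  refine hS.mem_of_tendsto (hasDerivAt_iff_tendsto_slope.1 h) (Filter.Eventually.of_forall
    fun s => ?_)
  exact S.smul_mem _ (S.sub_mem (hv s) (hv t))

theorem integral_mem_of_isClosed {E : Type*} [NormedAddCommGroup E] [NormedSpace ℝ E]
    [CompleteSpace E] {S : Submodule ℝ E} (hS : IsClosed (S : Set E)) {v : ℝ → E}
    (hv : ∀ t, v t ∈ S) (hi : Integrable v) : (∫ t, v t) ∈ S := by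
  have h1 := S.mkQL.integral_comp_comm hi
  have h2 : ∀ t, S.mkQL (v t) = 0 := fun t => (Submodule.Quotient.mk_eq_zero S).2 (hv t)
  simp only [h2, integral_zero] at h1
  exact (Submodule.Quotient.mk_eq_zero S).1 h1.symm

theorem convolution_ridge_mem {R : ℝ} {σ : C(ℝ, ℝ)} (η : C(ℝ, ℝ)) (hη : HasCompactSupport η)
    (τ : C(ℝ, ℝ)) (hτ : ∀ x, τ x = ∫ y, η y * σ (x - y)) (a b : ℝ) :
    monoRidge R 0 τ a b ∈ ridgeClosure R σ := by
  have hcont : Continuous fun y => η y • monoRidge R 0 σ a (b - y) :=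
    η.continuous.smul (continuous_monoRidge R 0 σ continuous_const (by fun_prop))
  have hint : Integrable fun y => η y • monoRidge R 0 σ a (b - y) :=
    hcont.integrable_of_hasCompactSupport (hη.smul_right)
  have heq : monoRidge R 0 τ a b = ∫ y, η y • monoRidge R 0 σ a (b - y) := by
    ext x
    rw [ContinuousMap.integral_apply hint]
    simp [monoRidge, hτ, add_sub_assoc]
  rw [heq]
  refine integral_mem_of_isClosed (Submodule.isClosed_topologicalClosure _) (fun y => ?_) hint
  exact Submodule.smul_mem _ _ (Submodule.le_topologicalClosure _
    (Submodule.subset_span ⟨(a, b - y), rfl⟩))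

theorem pow_mem_ridgeClosure {R : ℝ} {σ : C(ℝ, ℝ)} {τ : C(ℝ, ℝ)}
    (hτ : ContDiff ℝ (⊤ : ℕ∞) τ) (hmem : ∀ a b, monoRidge R 0 τ a b ∈ ridgeClosure R σ) {k : ℕ}
    {b : ℝ} (hb : iteratedDeriv k τ b ≠ 0) :
    monoRidge R k (ContinuousMap.const ℝ 1) 0 0 ∈ ridgeClosure R σ := by
  have hcd : ∀ k : ℕ, Continuous (iteratedDeriv k τ) := fun k =>
    hτ.continuous_iteratedDeriv k (by exact_mod_cast le_top)
  have hall : ∀ (k : ℕ) (a b : ℝ), monoRidge R k ⟨iteratedDeriv k τ, hcd k⟩ a b ∈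
      ridgeClosure R σ := by
    intro k
    induction k with
    | zero => simpa only [iteratedDeriv_zero] using! hmem
    | succ k ih =>
      intro a b
      refine hasDerivAt_mem_of_isClosed (Submodule.isClosed_topologicalClosure _) (fun t => ih t b)
        (hasDerivAt_monoRidge R k (fun x => ?_) a b)
      have := (hτ.differentiable_iteratedDeriv k
        (by exact_mod_cast WithTop.coe_lt_top _) x).hasDerivAt
      rwa [← iteratedDeriv_succ] at this
  convert! (ridgeClosure R σ).smul_mem (iteratedDeriv k τ b)⁻¹ (hall k 0 b) using 1
  ext x
  simp [monoRidge]
  field_simp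

theorem exists_smooth_nonaffine_convolution {σ : ℝ → ℝ} {L : NNReal} (hσ : LipschitzWith L σ)
    (hna : ¬ ∃ a c : ℝ, ∀ x, σ x = a * x + c) :
    ∃ η : C(ℝ, ℝ), HasCompactSupport η ∧ ∃ τ : C(ℝ, ℝ), (∀ x, τ x = ∫ y, η y * σ (x - y)) ∧
      ContDiff ℝ (⊤ : ℕ∞) τ ∧ LipschitzWith L τ ∧ ¬ ∃ a c : ℝ, ∀ x, τ x = a * x + c := by
  set φ : ℕ → ContDiffBump (0 : ℝ) := fun n =>
    ⟨1 / (n + 1) / 2, 1 / (n + 1), by positivity, half_lt_self (by positivity)⟩ with hφ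
  set τ : ℕ → ℝ → ℝ := fun n => convolution ((φ n).normed volume) σ
    (ContinuousLinearMap.lsmul ℝ ℝ) volume with hτ
  have hlim : ∀ x, Filter.Tendsto (fun n => τ n x) Filter.atTop (nhds (σ x)) :=
    ContDiffBump.convolution_tendsto_right_of_continuous tendsto_one_div_add_atTop_nhds_zero_nat
      hσ.continuous
  have heq : ∀ n x, τ n x = ∫ y, (φ n).normed volume y * σ (x - y) := fun n x => by
    simp [hτ, convolution_def]
  have hint : ∀ n x, Integrable fun y => (φ n).normed volume y * σ (x - y) := fun n x =>
    (((φ n).continuous_normed).mul (hσ.continuous.comp (by fun_prop))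
      ).integrable_of_hasCompactSupport ((φ n).hasCompactSupport_normed.mul_right)
  have hsmooth : ∀ n, ContDiff ℝ (⊤ : ℕ∞) (τ n) := fun n =>
    ((φ n).hasCompactSupport_normed).contDiff_convolution_left _ (φ n).contDiff_normed
      hσ.continuous.locallyIntegrable
  have hlip : ∀ n, LipschitzWith L (τ n) := by
    intro n
    refine LipschitzWith.of_dist_le_mul fun x y => ?_
    rw [Real.dist_eq, heq, heq, ← integral_sub (hint n x) (hint n y), ← Real.norm_eq_abs]
    have hn := (φ n).integrable_normed (μ := volume)
    calc _ ≤ ∫ z, (φ n).normed volume z * (L * dist x y) := by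
          refine norm_integral_le_of_norm_le (hn.mul_const _)
            (Filter.Eventually.of_forall fun z => ?_)
          rw [← mul_sub, norm_mul, Real.norm_of_nonneg ((φ n).nonneg_normed z)]
          refine mul_le_mul_of_nonneg_left ?_ ((φ n).nonneg_normed z)
          simpa [Real.dist_eq] using hσ.dist_le_mul (x - z) (y - z)
      _ = L * dist x y := by rw [integral_mul_const, (φ n).integral_normed, one_mul]
  obtain ⟨n, hn⟩ : ∃ n, ¬ ∃ a c : ℝ, ∀ x, τ n x = a * x + c := by
    by_contra! h
    refine hna ⟨σ 1 - σ 0, σ 0, fun x => ?_⟩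
    refine tendsto_nhds_unique (hlim x) ?_
    have h1 : ∀ n, τ n x = (τ n 1 - τ n 0) * x + τ n 0 := by
      intro n
      obtain ⟨a, c, hac⟩ := h n
      rw [hac x, hac 1, hac 0]
      ring
    simp only [h1]
    exact (((hlim 1).sub (hlim 0)).mul_const x).add (hlim 0)
  exact ⟨⟨_, (φ n).continuous_normed⟩, (φ n).hasCompactSupport_normed,
    ⟨τ n, (hsmooth n).continuous⟩, heq n, hsmooth n, hlip n, hn⟩

theorem ridgeClosure_eq_top {σ : C(ℝ, ℝ)} {L : NNReal} (hσ : LipschitzWith L σ)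
    (hna : ¬ ∃ a c : ℝ, ∀ x, σ x = a * x + c) (R : ℝ) : ridgeClosure R σ = ⊤ := by
  obtain ⟨η, hη, τ, hτ, hsm, hlip, hτna⟩ := exists_smooth_nonaffine_convolution hσ hna
  have hpow : ∀ k, monoRidge R k (ContinuousMap.const ℝ 1) 0 0 ∈ ridgeClosure R σ := by
    intro k
    have : ∃ b, iteratedDeriv k τ b ≠ 0 := by
      by_contra! h
      exact hτna (affine_of_lipschitz_of_iteratedDeriv_eq_zero hlip hsm h)
    obtain ⟨b, hb⟩ := this
    exact pow_mem_ridgeClosure hsm (convolution_ridge_mem η hη τ hτ) hb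
  have hpoly : (polynomialFunctions (Set.Icc (-R) R) : Set C(Set.Icc (-R) R, ℝ)) ⊆
      ridgeClosure R σ := by
    rw [polynomialFunctions_coe]
    rintro _ ⟨p, rfl⟩
    induction p using Polynomial.induction_on' with
    | add p q hp hq =>
      rw [map_add]
      exact (ridgeClosure R σ).add_mem hp hq
    | monomial n a =>
      convert! (ridgeClosure R σ).smul_mem a (hpow n) using 1
      ext x
      simp [monoRidge]
  refine eq_top_iff.2 fun f _ => ?_
  refine closure_minimal hpoly (Submodule.isClosed_topologicalClosure _) ?_
  rw [← Subalgebra.topologicalClosure_coe, polynomialFunctions_closure_eq_top]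
  exact trivial

theorem exists_ridgeSpan_approx {σ : ℝ → ℝ} {L : NNReal} (hσ : LipschitzWith L σ)
    (hna : ¬ ∃ a c : ℝ, ∀ x, σ x = a * x + c) {h : ℝ → ℝ} (hh : Continuous h) (R : ℝ) {α : ℝ}
    (hα : 0 < α) : ∃ g ∈ ridgeSpan σ, ∀ x, |x| ≤ R → |g x - h x| ≤ α := by
  set σ' : C(ℝ, ℝ) := ⟨σ, hσ.continuous⟩
  have hmem : (⟨fun x => h x, by fun_prop⟩ : C(Set.Icc (-R) R, ℝ)) ∈ ridgeClosure R σ' := by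
    rw [ridgeClosure_eq_top hσ hna]
    exact trivial
  obtain ⟨f, hf, hfd⟩ := Metric.mem_closure_iff.1 hmem α hα
  have hext : ∃ g ∈ ridgeSpan σ, ∀ x : Set.Icc (-R) R, f x = g x := by
    clear hfd
    induction hf using Submodule.span_induction with
    | mem f hf =>
      obtain ⟨⟨a, b⟩, rfl⟩ := hf
      exact ⟨_, Submodule.subset_span ⟨(a, b), rfl⟩, fun x => by simp [monoRidge, σ']⟩
    | zero => exact ⟨0, Submodule.zero_mem _, fun x => rfl⟩
    | add f f' _ _ ih ih' =>
      obtain ⟨g, hg, h1⟩ := ih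
      obtain ⟨g', hg', h2⟩ := ih'
      exact ⟨g + g', Submodule.add_mem _ hg hg', fun x => by simp [h1, h2]⟩
    | smul c f _ ih =>
      obtain ⟨g, hg, h1⟩ := ih
      exact ⟨c • g, Submodule.smul_mem _ c hg, fun x => by simp [h1]⟩
  obtain ⟨g, hg, hfg⟩ := hext
  refine ⟨g, hg, fun x hx => ?_⟩
  have h1 := (ContinuousMap.dist_apply_le_dist (⟨x, abs_le.1 hx⟩ : Set.Icc (-R) R)).trans hfd.le
  rw [Real.dist_eq, hfg, abs_sub_comm] at h1
  exact h1

theorem attainable_of_mem_shears {d : ℕ} {σ : ℝ → ℝ} {D : Submodule ℝ (Fin d → ℝ)}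
    {v : (Fin d → ℝ) → (Fin d → ℝ)} (hv : v ∈ shears σ D) :
    (fun x => x + v x) ∈ Attainable (ResNetFamily d σ) := by
  simpa using hv.2.2 1

theorem network_attainable {d : ℕ} {σ : ℝ → ℝ} {i₀ i₁ : Fin d} (hi : i₁ ≠ i₀)
    {s H : Fin d → ℝ → ℝ} {h u : ℝ → ℝ} (hs : ∀ j, s j ∈ ridgeSpan σ)
    (hH : ∀ j, H j ∈ ridgeSpan σ) (hh : h ∈ ridgeSpan σ)
    (hu : (fun x : Fin d → ℝ => fun j => if j = i₀ then x i₀ else u (x j)) ∈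
      Attainable (ResNetFamily d σ)) :
    ∃ φ ∈ Attainable (ResNetFamily d σ), ∀ x, ∃ z,
      z = x i₀ + ∑ j ∈ Finset.univ.erase i₀, s j (x j) ∧
      (∀ j, j ≠ i₀ → φ x j = u (x j) + H j z) ∧ φ x i₀ = z + h (φ x i₁) := by
  set D₀ : Submodule ℝ (Fin d → ℝ) :=
    ⨅ j ∈ (Finset.univ.erase i₀ : Finset (Fin d)), LinearMap.ker (LinearMap.proj j) with hD₀
  set D₁ : Submodule ℝ (Fin d → ℝ) := LinearMap.ker (LinearMap.proj i₀)
  have hD₀' : ∀ z, z ∈ D₀ ↔ ∀ j, j ≠ i₀ → z j = 0 := fun z => by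
    simp [hD₀, Submodule.mem_iInf]
  have hD₁' : ∀ z, z ∈ D₁ ↔ z i₀ = 0 := fun z => by simp [D₁]
  have he₀ : (Pi.single i₀ 1 : Fin d → ℝ) ∈ D₀ := (hD₀' _).2 fun j hj => by simp [hj]
  have h1 := attainable_of_mem_shears (Submodule.sum_mem (shears σ D₀)
    (t := Finset.univ.erase i₀) fun j hj => single_mem_shears he₀
      (fun z hz => (hD₀' z).1 hz j (Finset.ne_of_mem_erase hj)) (hs j))
  have h3 := attainable_of_mem_shears (Submodule.sum_mem (shears σ D₁)
    (t := Finset.univ.erase i₀) fun j hj => single_mem_shears (i := j) (j := i₀)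
      ((hD₁' _).2 (by simp [(Finset.ne_of_mem_erase hj).symm])) (fun z hz => (hD₁' z).1 hz) (hH j))
  have h4 := attainable_of_mem_shears (single_mem_shears he₀ (fun z hz => (hD₀' z).1 hz i₁ hi) hh)
  refine ⟨_, attainable_comp h4 (attainable_comp h3 (attainable_comp hu h1)), fun x =>
    ⟨_, rfl, fun j hj => ?_, ?_⟩⟩
  · simp [Finset.sum_apply, Pi.single_apply, hj]
  · simp [Finset.sum_apply, Pi.single_apply, hi]

theorem exists_plateau {ι : Type*} [Fintype ι] (p g : ι → ℝ) {r r' : ℝ} (hr : r < r')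
    (hsep : ∀ c c', c ≠ c' → r + r' ≤ |p c - p c'|) :
    ∃ s : ℝ → ℝ, Continuous s ∧ (∀ v, |s v| ≤ ∑ c, |g c|) ∧ ∀ c v, |v - p c| ≤ r → s v = g c := by
  classical
  have hpos : 0 < r' - r := sub_pos.2 hr
  set β : ℝ → ℝ := fun v => max 0 (min 1 ((r' - |v|) / (r' - r))) with hβ
  refine ⟨fun v => ∑ c, g c * β (v - p c), by fun_prop, fun v => ?_, fun c v hv => ?_⟩
  · refine (Finset.abs_sum_le_sum_abs _ _).trans (Finset.sum_le_sum fun c _ => ?_)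
    have h0 : 0 ≤ β (v - p c) := le_max_left _ _
    have h1 : β (v - p c) ≤ 1 := max_le zero_le_one (min_le_left _ _)
    rw [abs_mul, abs_of_nonneg h0]
    exact mul_le_of_le_one_right (abs_nonneg _) h1
  · change ∑ c, g c * β (v - p c) = g c
    rw [Finset.sum_eq_single c]
    · have : 1 ≤ (r' - |v - p c|) / (r' - r) := by
        rw [le_div_iff₀ hpos]
        linarith
      simp [hβ, min_eq_left this]
    · intro c' _ hc'
      have h1 := hsep c' c hc'
      have h2 : |p c' - p c| ≤ |v - p c'| + |v - p c| := by
        rw [abs_sub_comm v (p c')]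
        exact abs_sub_le _ _ _
      have : (r' - |v - p c'|) / (r' - r) ≤ 0 :=
        div_nonpos_of_nonpos_of_nonneg (by linarith) hpos.le
      simp [hβ, max_eq_left ((min_le_right _ _).trans this)]
    · simp

theorem exists_injective_near {N : ℕ} (v : Fin N → ℝ) {η : ℝ} (hη : 0 < η) :
    ∃ w : Fin N → ℝ, Function.Injective w ∧ ∀ c, |w c - v c| ≤ η := by
  set bad : Set ℝ := Set.range fun q : Fin N × Fin N => (v q.1 - v q.2) / ((q.2 : ℝ) - q.1)
  have hbad : bad.Finite := Set.finite_range _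
  obtain ⟨t, ht, htb⟩ := ((Set.Ioo_infinite (show (0 : ℝ) < η / (N + 1) by positivity)).sdiff
    hbad).nonempty
  refine ⟨fun c => v c + t * c, fun c c' h => ?_, fun c => ?_⟩
  · by_contra hne
    have hne' : ((c' : ℕ) : ℝ) - (c : ℕ) ≠ 0 :=
      sub_ne_zero.2 fun h => hne (Fin.ext (by exact_mod_cast h.symm))
    refine htb ⟨(c, c'), ?_⟩
    rw [div_eq_iff hne']
    simp only at h
    linarith
  · have hc : ((c : ℕ) : ℝ) ≤ N + 1 := by
      have : (c : ℕ) ≤ N + 1 := by omega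
      exact_mod_cast this
    rw [add_sub_cancel_left, abs_of_nonneg (mul_nonneg ht.1.le (Nat.cast_nonneg _))]
    calc t * (c : ℕ) ≤ η / (N + 1) * (N + 1) := by
          gcongr
          exact ht.2.le
      _ = η := by field_simp

theorem exists_separation {N : ℕ} {w : Fin N → ℝ} (hw : Function.Injective w) :
    ∃ ρ : ℝ, 0 < ρ ∧ ∀ c c', c ≠ c' → 3 * ρ ≤ |w c - w c'| := by
  have : ∀ᶠ ρ in nhdsWithin (0 : ℝ) (Set.Ioi 0), ∀ c c', c ≠ c' → 3 * ρ ≤ |w c - w c'| := by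
    simp only [Filter.eventually_all]
    intro c c' hne
    have hpos : 0 < |w c - w c'| := abs_pos.2 (sub_ne_zero.2 fun h => hne (hw h))
    filter_upwards [Ioo_mem_nhdsGT (show 0 < |w c - w c'| / 3 by positivity)] with ρ hρ
    linarith [hρ.2]
  obtain ⟨ρ, h, hρ⟩ := (this.and self_mem_nhdsWithin).exists
  exact ⟨ρ, hρ, h⟩

/-- The centre of the `k`-th interval of length `δ` to the right of `-R`. -/
noncomputable def cellCenter (R δ : ℝ) (k : ℕ) : ℝ := δ * (k + 1 / 2) - R

theorem le_abs_cellCenter_sub {R δ : ℝ} (hδ : 0 < δ) {k l : ℕ} (h : k ≠ l) :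
    δ ≤ |cellCenter R δ k - cellCenter R δ l| := by
  have h1 : cellCenter R δ k - cellCenter R δ l = δ * ((k : ℤ) - (l : ℤ) : ℤ) := by
    simp only [cellCenter]
    push_cast
    ring
  have h2 : (1 : ℤ) ≤ |(k : ℤ) - (l : ℤ)| := Int.one_le_abs (by omega)
  rw [h1, abs_mul, abs_of_pos hδ, ← Int.cast_abs]
  exact le_mul_of_one_le_right hδ.le (by exact_mod_cast h2)

theorem cellCenter_code {d m : ℕ} (R δ : ℝ) {i₀ : Fin d} (hi₀ : (i₀ : ℕ) = 0)
    (k : Fin d → Fin m) :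
    cellCenter R δ (finFunctionFinEquiv k) =
      cellCenter R δ (k i₀) + ∑ j ∈ Finset.univ.erase i₀, δ * ((k j : ℝ) * (m : ℝ) ^ (j : ℕ)) := by
  have h1 : ((finFunctionFinEquiv k : ℕ) : ℝ) = ∑ j, (k j : ℝ) * (m : ℝ) ^ (j : ℕ) := by
    rw [finFunctionFinEquiv_apply]
    push_cast
    rfl
  rw [← Finset.add_sum_erase _ _ (Finset.mem_univ i₀)] at h1
  simp only [cellCenter, h1, ← Finset.mul_sum, hi₀, pow_zero]
  ring

/-- Attainable maps sending each of the `m ^ d` cells, slightly shrunk, close to a prescribed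
point, with a bound independent of the amount of shrinking. -/
theorem exists_cell_network {d m : ℕ} {σ : ℝ → ℝ} {L : NNReal} (hσ : LipschitzWith L σ)
    (hna : ¬ ∃ a c : ℝ, ∀ x, σ x = a * x + c) {i₀ i₁ : Fin d} (hi : i₁ ≠ i₀)
    (hi₀ : (i₀ : ℕ) = 0) {R δ : ℝ} (hR : 0 < R) (hδ : 0 < δ) (y : Fin (m ^ d) → Fin d → ℝ)
    (hy : Function.Injective fun c => y c i₁) :
    ∃ B : ℝ, 0 ≤ B ∧ ∀ r, 0 < r → r < δ / 2 → ∃ φ ∈ Attainable (ResNetFamily d σ),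
      (∀ x, (∀ j, |x j| ≤ R) → ∀ j, |φ x j| ≤ B) ∧
      ∀ (k : Fin d → Fin m) (x : Fin d → ℝ), (∀ j, |x j| ≤ R) →
        (∀ j, |x j - cellCenter R δ (k j)| ≤ r) →
        ∀ j, |φ x j - y (finFunctionFinEquiv k) j| ≤ δ := by
  obtain ⟨ρ₀, hρ₀, hsep₀⟩ := exists_separation hy
  set ρ : ℝ := min ρ₀ δ with hρdef
  have hρ : 0 < ρ := lt_min hρ₀ hδ
  have hρδ : ρ ≤ δ := min_le_right _ _
  have hsep : ∀ c c', c ≠ c' → ρ + 2 * ρ ≤ |y c i₁ - y c' i₁| := fun c c' hne => by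
    linarith [hsep₀ c c' hne, min_le_left ρ₀ δ]
  have hd : (0 : ℝ) < d := by exact_mod_cast i₀.pos
  set S : Fin d → ℝ := fun j => ∑ k : Fin m, |δ * ((k : ℝ) * (m : ℝ) ^ (j : ℕ))| with hS
  set Y : Fin d → ℝ := fun j => ∑ c, |y c j| with hY
  set Z : ℝ := ∑ c : Fin (m ^ d), |y c i₀ - cellCenter R δ c| with hZ
  have hS0 : ∀ j, 0 ≤ S j := fun j => Finset.sum_nonneg fun _ _ => abs_nonneg _
  have hY0 : ∀ j, 0 ≤ Y j := fun j => Finset.sum_nonneg fun _ _ => abs_nonneg _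
  have hZ0 : 0 ≤ Z := Finset.sum_nonneg fun _ _ => abs_nonneg _
  set R₁ : ℝ := R + ∑ j ∈ Finset.univ.erase i₀, (S j + δ) with hR₁
  have hR₁0 : 0 ≤ R₁ := add_nonneg hR.le (Finset.sum_nonneg fun j _ => by linarith [hS0 j])
  refine ⟨R₁ + ∑ j, Y j + Z + δ, ?_, fun r hr hrδ => ?_⟩
  · have := Finset.sum_nonneg fun j (_ : j ∈ Finset.univ) => hY0 j
    linarith
  set α : ℝ := (δ / 2 - r) / (2 * d) with hα
  have hd1 : (1 : ℝ) ≤ d := by exact_mod_cast i₀.pos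
  have hα0 : 0 < α := div_pos (by linarith) (by positivity)
  have hdα : d * α = (δ / 2 - r) / 2 := by rw [hα]; field_simp
  have hαδ : α ≤ δ := by nlinarith
  set r' : ℝ := r + d * α with hr'
  have hr'δ : r' < δ / 2 := by rw [hr', hdα]; linarith
  choose s hsc hsb hsv using fun j : Fin d =>
    exists_plateau (ι := Fin m) (fun k => cellCenter R δ k)
      (fun k => δ * ((k : ℝ) * (m : ℝ) ^ (j : ℕ))) hrδ fun c c' hne => by
        linarith [le_abs_cellCenter_sub (R := R) hδ (Fin.val_ne_of_ne hne)]
  choose H hHc hHb hHv using fun j : Fin d =>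
    exists_plateau (ι := Fin (m ^ d)) (fun c => cellCenter R δ c) (fun c => y c j) hr'δ
      fun c c' hne => by linarith [le_abs_cellCenter_sub (R := R) hδ (Fin.val_ne_of_ne hne)]
  obtain ⟨h, hhc, hhb, hhv⟩ := exists_plateau (fun c => y c i₁)
    (fun c : Fin (m ^ d) => y c i₀ - cellCenter R δ c) (show ρ < 2 * ρ by linarith) hsep
  choose s' hs' hss using fun j => exists_ridgeSpan_approx hσ hna (hsc j) R hα0
  choose H' hH' hHH using fun j => exists_ridgeSpan_approx hσ hna (hHc j) R₁ (half_pos hρ)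
  obtain ⟨h', hh', hhh⟩ := exists_ridgeSpan_approx hσ hna hhc (Y i₁ + ρ) (half_pos hρ)
  obtain ⟨u, hu, huA⟩ := exists_contraction hσ hna i₀ hR (half_pos hρ)
  obtain ⟨φ, hφA, hφ⟩ := network_attainable hi hs' hH' hh' huA
  have key : ∀ x, (∀ j, |x j| ≤ R) → ∃ z, z = x i₀ + ∑ j ∈ Finset.univ.erase i₀, s' j (x j) ∧
      |z| ≤ R₁ ∧ (∀ j, j ≠ i₀ → |φ x j - H j z| ≤ ρ) ∧ |φ x i₀ - (z + h (φ x i₁))| ≤ ρ / 2 := by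
    intro x hx
    obtain ⟨z, hz, hj, h0⟩ := hφ x
    have hzR : |z| ≤ R₁ := by
      rw [hz]
      refine (abs_add_le _ _).trans (add_le_add (hx i₀) ((Finset.abs_sum_le_sum_abs _ _).trans
        (Finset.sum_le_sum fun j _ => ?_)))
      have h1 := hss j (x j) (hx j)
      have h2 := hsb j (x j)
      have h3 := abs_sub_abs_le_abs_sub (s' j (x j)) (s j (x j))
      linarith
    have hjb : ∀ j, j ≠ i₀ → |φ x j - H j z| ≤ ρ := by
      intro j hne
      rw [hj j hne]
      have h1 := hHH j z hzR
      have h2 := hu (x j) (hx j)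
      calc |u (x j) + H' j z - H j z| = |u (x j) + (H' j z - H j z)| := by ring_nf
        _ ≤ |u (x j)| + |H' j z - H j z| := abs_add_le _ _
        _ ≤ ρ := by linarith
    refine ⟨z, hz, hzR, hjb, ?_⟩
    have h1 : |φ x i₁| ≤ Y i₁ + ρ := by
      have h2 := abs_sub_abs_le_abs_sub (φ x i₁) (H i₁ z)
      linarith [hjb i₁ hi, hHb i₁ z]
    rw [h0, add_sub_add_left_eq_sub]
    exact hhh _ h1
  refine ⟨φ, hφA, fun x hx j => ?_, fun k x hx hk j => ?_⟩
  · obtain ⟨z, -, hzR, hjb, h0⟩ := key x hx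
    have hsum : ∀ j, Y j ≤ ∑ j, Y j := fun j =>
      Finset.single_le_sum (f := Y) (fun j _ => hY0 j) (Finset.mem_univ j)
    by_cases hj : j = i₀
    · subst hj
      have h1 := abs_sub_abs_le_abs_sub (φ x j) (z + h (φ x i₁))
      have h2 := abs_add_le z (h (φ x i₁))
      linarith [hhb (φ x i₁), hsum j, hY0 j]
    · have h1 := abs_sub_abs_le_abs_sub (φ x j) (H j z)
      linarith [hjb j hj, hHb j z, hsum j]
  · obtain ⟨z, hz, hzR, hjb, h0⟩ := key x hx
    set c := finFunctionFinEquiv k with hc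
    have hzc : |z - cellCenter R δ c| ≤ r' := by
      rw [hz, hc, cellCenter_code R δ hi₀ k]
      have h1 : ∀ j ∈ Finset.univ.erase i₀,
          |s' j (x j) - δ * ((k j : ℝ) * (m : ℝ) ^ (j : ℕ))| ≤ α := fun j _ => by
        rw [← hsv j (k j) (x j) (hk j)]
        exact hss j (x j) (hx j)
      calc _ = |(x i₀ - cellCenter R δ (k i₀)) + ∑ j ∈ Finset.univ.erase i₀,
              (s' j (x j) - δ * ((k j : ℝ) * (m : ℝ) ^ (j : ℕ)))| := by
            rw [Finset.sum_sub_distrib]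
            congr 1
            ring
        _ ≤ r + ∑ j ∈ Finset.univ.erase i₀, α :=
            (abs_add_le _ _).trans (add_le_add (hk i₀)
              ((Finset.abs_sum_le_sum_abs _ _).trans (Finset.sum_le_sum h1)))
        _ ≤ r + d * α := by
            rw [Finset.sum_const, nsmul_eq_mul]
            gcongr
            exact (Finset.card_erase_le).trans (by simp)
    have hjc : ∀ j, j ≠ i₀ → |φ x j - y c j| ≤ ρ := fun j hj => by
      have := hjb j hj
      rwa [hHv j c z hzc] at this
    by_cases hj : j = i₀
    · subst hj
      have h2 := hhv c (φ x i₁) (hjc i₁ hi)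
      rw [h2] at h0
      calc |φ x j - y c j| = |(φ x j - (z + (y c j - cellCenter R δ c))) +
              (z - cellCenter R δ c)| := by ring_nf
        _ ≤ ρ / 2 + r' := (abs_add_le _ _).trans (add_le_add h0 hzc)
        _ ≤ δ := by linarith
    · exact (hjc j hj).trans hρδ

theorem eLpNorm_le_of_norm_le_add_indicator {α E : Type*} [MeasurableSpace α]
    [NormedAddCommGroup E] {μ : Measure α} {g : α → E} {S : Set α} (hS : MeasurableSet S)
    {p : ENNReal} (hp : 1 ≤ p) (hp' : p ≠ ⊤) {a b : ℝ} (ha : 0 ≤ a) (hb : 0 ≤ b)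
    (h : ∀ᵐ x ∂μ, ‖g x‖ ≤ a + S.indicator (fun _ => b) x) :
    eLpNorm g p μ ≤ ENNReal.ofReal a * μ Set.univ ^ (1 / p.toReal) +
      ENNReal.ofReal b * μ S ^ (1 / p.toReal) := by
  have hp0 : p ≠ 0 := (zero_lt_one.trans_le hp).ne'
  calc eLpNorm g p μ ≤ eLpNorm ((fun _ => a) + S.indicator fun _ => b) p μ :=
        eLpNorm_mono_ae (h.mono fun x hx => hx.trans (le_abs_self _))
    _ ≤ eLpNorm (fun _ => a) p μ + eLpNorm (S.indicator fun _ => b) p μ :=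
        eLpNorm_add_le aestronglyMeasurable_const
          (aestronglyMeasurable_const.indicator hS) hp
    _ ≤ _ := by
        rw [eLpNorm_indicator_const hS hp0 hp', eLpNorm_const' _ hp0 hp',
          Real.enorm_of_nonneg ha, Real.enorm_of_nonneg hb]

/-- The points lying in none of the `m ^ d` closed cubes of half-width `r` around the cell
centres. -/
def cellGap (d m : ℕ) (R δ r : ℝ) : Set (Fin d → ℝ) :=
  {x | ¬ ∃ k : Fin d → Fin m, ∀ j, |x j - cellCenter R δ (k j)| ≤ r}

theorem measurableSet_cellGap (d m : ℕ) (R δ r : ℝ) : MeasurableSet (cellGap d m R δ r) := by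
  have : cellGap d m R δ r =
      (⋃ k : Fin d → Fin m, ⋂ j, {x | |x j - cellCenter R δ (k j)| ≤ r})ᶜ := by
    ext x
    simp [cellGap]
  rw [this]
  refine (MeasurableSet.iUnion fun k => MeasurableSet.iInter fun j => ?_).compl
  exact (isClosed_le (by fun_prop) continuous_const).measurableSet

theorem exists_abs_sub_cellCenter_lt {m : ℕ} {R δ t : ℝ} (hδ : 0 < δ) (hm : δ * m = 2 * R)
    (ht : |t| ≤ R) (hgrid : ∀ i : Fin (m + 1), t ≠ δ * i - R) :
    ∃ k : Fin m, |t - cellCenter R δ k| < δ / 2 := by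
  obtain ⟨h1, h2⟩ := abs_le.1 ht
  have h0 : 0 ≤ (t + R) / δ := div_nonneg (by linarith) hδ.le
  have hle := Nat.floor_le h0
  have hlt := Nat.lt_floor_add_one ((t + R) / δ)
  rw [le_div_iff₀ hδ] at hle
  rw [div_lt_iff₀ hδ] at hlt
  set k := ⌊(t + R) / δ⌋₊
  have hkm : k < m + 1 := by
    have : (k : ℝ) < m + 1 := by nlinarith
    exact_mod_cast this
  have hk := hgrid ⟨k, hkm⟩
  have hkm' : k < m := by
    refine lt_of_le_of_ne (Nat.lt_succ_iff.1 hkm) fun h => hk ?_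
    have : (k : ℝ) = m := by exact_mod_cast h
    rw [this] at hle
    simp only [this]
    linarith
  have hk' : k * δ < t + R := lt_of_le_of_ne hle fun h => hk (by simp only; linarith)
  refine ⟨⟨k, hkm'⟩, abs_lt.2 ⟨?_, ?_⟩⟩ <;> simp only [cellCenter] <;> linarith

theorem exists_measure_cellGap_lt {d m : ℕ} {R δ : ℝ} (hδ : 0 < δ) (hm : δ * m = 2 * R)
    {K : Set (Fin d → ℝ)} (hK : IsCompact K) (hKR : ∀ x ∈ K, ∀ j, |x j| ≤ R) {θ : ENNReal}
    (hθ : 0 < θ) :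
    ∃ r, 0 < r ∧ r < δ / 2 ∧ volume.restrict K (cellGap d m R δ r) < θ := by
  set r : ℕ → ℝ := fun n => δ / 2 - δ / 4 * (1 / ((n : ℝ) + 1)) with hr
  have hr0 : ∀ n, 0 < r n := fun n => by
    have : 1 / ((n : ℝ) + 1) ≤ 1 := by
      rw [div_le_one (by positivity)]
      linarith [(Nat.cast_nonneg n : (0 : ℝ) ≤ n)]
    simp only [hr]
    nlinarith
  have hr1 : ∀ n, r n < δ / 2 := fun n => by
    have : 0 < δ / 4 * (1 / ((n : ℝ) + 1)) := by positivity
    simp only [hr]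
    linarith
  have hrm : Monotone r := fun n n' hn => by
    have := Nat.one_div_le_one_div (α := ℝ) hn
    simp only [hr]
    gcongr
  have hrt : Filter.Tendsto r Filter.atTop (nhds (δ / 2)) := by
    have := (tendsto_one_div_add_atTop_nhds_zero_nat (𝕜 := ℝ)).const_mul (δ / 4)
    simpa [hr] using this.const_sub (δ / 2)
  have hfin : volume.restrict K (cellGap d m R δ (r 0)) ≠ ⊤ := by
    refine ((measure_mono (Set.subset_univ _)).trans_lt ?_).ne
    rw [Measure.restrict_apply_univ]
    exact hK.measure_lt_top
  have hlim := tendsto_measure_iInter_atTop (μ := volume.restrict K)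
    (s := fun n => cellGap d m R δ (r n))
    (fun n => (measurableSet_cellGap d m R δ (r n)).nullMeasurableSet)
    (fun n n' hn x hx ⟨k, hk⟩ => hx ⟨k, fun j => (hk j).trans (hrm hn)⟩) ⟨0, hfin⟩
  have hzero : volume.restrict K (⋂ n, cellGap d m R δ (r n)) = 0 := by
    have hgrid : volume (⋃ j : Fin d, ⋃ i : Fin (m + 1), {x : Fin d → ℝ | x j = δ * i - R}) = 0 :=
      measure_iUnion_null fun j => measure_iUnion_null fun i => Measure.pi_hyperplane _ _ _
    rw [Measure.restrict_apply
      (MeasurableSet.iInter fun n => measurableSet_cellGap d m R δ (r n))]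
    refine measure_mono_null (fun x hx => ?_) hgrid
    by_contra hx'
    simp only [Set.mem_iUnion, Set.mem_ofPred_eq, not_exists] at hx'
    choose k hk using fun j => exists_abs_sub_cellCenter_lt hδ hm (hKR x hx.2 j) (hx' j)
    have : ∀ᶠ n in Filter.atTop, ∀ j, |x j - cellCenter R δ (k j)| < r n :=
      Filter.eventually_all.2 fun j => hrt.eventually_const_lt (hk j)
    obtain ⟨n, hn⟩ := this.exists
    exact Set.mem_iInter.1 hx.1 n ⟨k, fun j => (hn j).le⟩
  rw [hzero] at hlim
  obtain ⟨n, hn⟩ := (hlim.eventually_lt_const hθ).exists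
  exact ⟨r n, hr0 n, hr1 n, hn⟩

theorem abs_cellCenter_le {m : ℕ} {R δ : ℝ} (hδ : 0 < δ) (hm : δ * m = 2 * R) (k : Fin m) :
    |cellCenter R δ k| ≤ R := by
  have hk : ((k : ℕ) : ℝ) + 1 ≤ m := by exact_mod_cast k.2
  have hk0 : (0 : ℝ) ≤ (k : ℕ) := Nat.cast_nonneg _
  simp only [cellCenter]
  rw [abs_le]
  constructor <;> nlinarith

theorem tendsto_const_mul_rpow_zero {c : ENNReal} (hc : c ≠ ⊤) {q : ℝ} (hq : 0 < q) :
    Filter.Tendsto (fun s : ENNReal => c * s ^ q) (nhds 0) (nhds 0) := by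
  have h := ENNReal.Tendsto.const_mul (a := c)
    ((ENNReal.continuous_rpow_const (y := q)).tendsto 0) (Or.inr hc)
  simpa [ENNReal.zero_rpow_of_pos hq] using h

/-- Attainable maps uniformly bounded on a cube and uniformly close to `F` off the gaps between
the cells of a fine subdivision. -/
theorem exists_network_approx {d : ℕ} (hd : 2 ≤ d) {σ : ℝ → ℝ} {L : NNReal}
    (hσ : LipschitzWith L σ) (hna : ¬ ∃ a c : ℝ, ∀ x, σ x = a * x + c)
    {F : (Fin d → ℝ) → (Fin d → ℝ)} (hF : Continuous F) {R η : ℝ} (hR : 0 < R) (hη : 0 < η) :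
    ∃ (m : ℕ) (δ B : ℝ), 0 < δ ∧ δ * m = 2 * R ∧ 0 ≤ B ∧ ∀ r, 0 < r → r < δ / 2 →
      ∃ φ ∈ Attainable (ResNetFamily d σ), ∀ x, (∀ j, |x j| ≤ R) →
        ‖F x - φ x‖ ≤ 3 * η + (cellGap d m R δ r).indicator (fun _ => B) x := by
  have hball : ∀ x : Fin d → ℝ, x ∈ Metric.closedBall 0 R ↔ ∀ j, |x j| ≤ R := fun x => by
    simp [pi_norm_le_iff_of_nonneg hR.le]
  have hcomp : IsCompact (Metric.closedBall (0 : Fin d → ℝ) R) := isCompact_closedBall _ _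
  obtain ⟨C, hC⟩ := hcomp.exists_bound_of_continuousOn hF.continuousOn
  obtain ⟨δ₀, hδ₀, huc⟩ := Metric.uniformContinuousOn_iff.1
    (hcomp.uniformContinuousOn_of_continuous hF.continuousOn) η hη
  obtain ⟨n, hn⟩ := exists_nat_gt (2 * R / min δ₀ η)
  have hn0 : (0 : ℝ) < n := (by positivity : 0 < 2 * R / min δ₀ η).trans hn
  set δ : ℝ := 2 * R / n with hδdef
  have hδ : 0 < δ := by positivity
  have hm : δ * n = 2 * R := by rw [hδdef]; field_simp
  have hδmin : δ < min δ₀ η := by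
    rw [hδdef, div_lt_iff₀ hn0]
    rwa [div_lt_iff₀ (by positivity), mul_comm (n : ℝ)] at hn
  set i₀ : Fin d := ⟨0, by omega⟩
  set i₁ : Fin d := ⟨1, by omega⟩
  have hi : i₁ ≠ i₀ := by simp [i₀, i₁]
  set ctr : (Fin d → Fin n) → Fin d → ℝ := fun k j => cellCenter R δ (k j) with hctr
  have hctrR : ∀ k, ctr k ∈ Metric.closedBall 0 R := fun k =>
    (hball _).2 fun j => abs_cellCenter_le hδ hm (k j)
  obtain ⟨w, hw, hwv⟩ :=
    exists_injective_near (fun c => F (ctr (finFunctionFinEquiv.symm c)) i₁) hη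
  set y : Fin (n ^ d) → Fin d → ℝ := fun c =>
    Function.update (F (ctr (finFunctionFinEquiv.symm c))) i₁ (w c) with hy
  have hyF : ∀ k j, |y (finFunctionFinEquiv k) j - F (ctr k) j| ≤ η := fun k j => by
    by_cases hj : j = i₁
    · subst hj
      simpa [hy] using hwv (finFunctionFinEquiv k)
    · simp [hy, hj, hη.le]
  obtain ⟨B, hB, hnet⟩ :=
    exists_cell_network (i₀ := i₀) hσ hna hi rfl hR hδ y (by simpa [hy] using hw)
  refine ⟨n, δ, |C| + B, hδ, hm, by positivity, fun r hr hrδ => ?_⟩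
  obtain ⟨φ, hφ, hφB, hφy⟩ := hnet r hr hrδ
  refine ⟨φ, hφ, fun x hx => ?_⟩
  by_cases hxg : x ∈ cellGap d n R δ r
  · rw [Set.indicator_of_mem hxg]
    have h1 : ‖φ x‖ ≤ B := (pi_norm_le_iff_of_nonneg hB).2 (hφB x hx)
    have h2 := (hC x ((hball x).2 hx)).trans (le_abs_self C)
    linarith [norm_sub_le (F x) (φ x)]
  · rw [Set.indicator_of_notMem hxg, add_zero, pi_norm_le_iff_of_nonneg (by positivity)]
    obtain ⟨k, hk⟩ := not_not.1 hxg
    intro j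
    have hdist : dist x (ctr k) < δ₀ := by
      refine ((dist_pi_le_iff hr.le).2 fun j => hk j).trans_lt ?_
      linarith [hδmin.trans_le (min_le_left δ₀ η)]
    have h1 := (dist_le_pi_dist (F x) (F (ctr k)) j).trans
      (huc x ((hball x).2 hx) _ (hctrR k) hdist).le
    rw [Real.dist_eq] at h1
    have h2 := hφy k x hx hk j
    have h3 := hyF k j
    rw [abs_le] at h1 h2 h3
    rw [Pi.sub_apply, Real.norm_eq_abs, abs_le]
    have := hδmin.trans_le (min_le_right δ₀ η)
    constructor <;> linarith

/-- Continuous-time ResNets with a non-affine Lipschitz activation possess the UAP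
in the `L^p` sense for every `1 ≤ p < ∞`. -/
theorem resnet_uap {d : ℕ} (hd : 2 ≤ d) (σ : ℝ → ℝ)
    (hLip : ∃ L : NNReal, LipschitzWith L σ)
    (hNonAffine : ¬ ∃ (a c : ℝ), ∀ x : ℝ, σ x = a * x + c)
    (p : ℝ) (hp : 1 ≤ p) :
    ∀ (F : (Fin d → ℝ) → (Fin d → ℝ)), Continuous F →
      ∀ (K : Set (Fin d → ℝ)), IsCompact K →
        ∀ ε : ℝ, 0 < ε →
          ∃ φ ∈ Attainable (ResNetFamily d σ),
            eLpNorm (fun x => F x - φ x) (ENNReal.ofReal p) (volume.restrict K)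
              < ENNReal.ofReal ε := by
  obtain ⟨L, hσ⟩ := hLip
  intro F hF K hK ε hε
  have hε2 : 0 < ENNReal.ofReal (ε / 2) := ENNReal.ofReal_pos.2 (half_pos hε)
  have hp1 : 1 ≤ ENNReal.ofReal p := by simpa using ENNReal.ofReal_le_ofReal hp
  have hq : 0 < 1 / (ENNReal.ofReal p).toReal := by
    rw [ENNReal.toReal_ofReal (by linarith)]
    positivity
  set q := 1 / (ENNReal.ofReal p).toReal
  obtain ⟨R, hR, hKR⟩ : ∃ R : ℝ, 0 < R ∧ ∀ x ∈ K, ∀ j, |x j| ≤ R := by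
    obtain ⟨R, hR⟩ := hK.isBounded.exists_norm_le
    exact ⟨max R 1, by positivity, fun x hx j =>
      (norm_le_pi_norm x j).trans ((hR x hx).trans (le_max_left _ _))⟩
  have hvol : volume.restrict K Set.univ ^ q ≠ ⊤ := by
    rw [Measure.restrict_apply_univ]
    exact ENNReal.rpow_ne_top_of_nonneg hq.le hK.measure_lt_top.ne
  obtain ⟨η, hη, hηε⟩ : ∃ η : ℝ, 0 < η ∧
      ENNReal.ofReal (3 * η) * volume.restrict K Set.univ ^ q < ENNReal.ofReal (ε / 2) := by
    have h1 : Filter.Tendsto (fun η : ℝ => ENNReal.ofReal (3 * η)) (nhds 0) (nhds 0) := by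
      have : Continuous fun η : ℝ => ENNReal.ofReal (3 * η) :=
        ENNReal.continuous_ofReal.comp (continuous_const.mul continuous_id)
      simpa using this.tendsto 0
    have h2 := ENNReal.Tendsto.mul_const h1 (Or.inr hvol)
    rw [zero_mul] at h2
    obtain ⟨η, h, hη⟩ := (((h2.mono_left nhdsWithin_le_nhds).eventually_lt_const hε2).and
      (self_mem_nhdsWithin : Set.Ioi (0 : ℝ) ∈ nhdsWithin 0 (Set.Ioi 0))).exists
    exact ⟨η, hη, h⟩
  obtain ⟨m, δ, B, hδ, hm, hB, hnet⟩ := exists_network_approx hd hσ hNonAffine hF hR hη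
  obtain ⟨θ, hθ, hθB⟩ := ENNReal.nhds_zero_basis.eventually_iff.1
    ((tendsto_const_mul_rpow_zero (ENNReal.ofReal_ne_top (r := B)) hq).eventually_lt_const hε2)
  obtain ⟨r, hr, hrδ, hrθ⟩ := exists_measure_cellGap_lt hδ hm hK hKR hθ
  obtain ⟨φ, hφ, hφF⟩ := hnet r hr hrδ
  refine ⟨φ, hφ, (eLpNorm_le_of_norm_le_add_indicator (measurableSet_cellGap d m R δ r) hp1
    ENNReal.ofReal_ne_top (a := 3 * η) (by positivity) hB
    ((ae_restrict_mem hK.measurableSet).mono fun x hx => hφF x (hKR x hx))).trans_lt ?_⟩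
  calc _ < ENNReal.ofReal (ε / 2) + ENNReal.ofReal (ε / 2) := ENNReal.add_lt_add hηε (hθB hrθ)
    _ = ENNReal.ofReal ε := by
        rw [← ENNReal.ofReal_add (half_pos hε).le (half_pos hε).le, add_halves]
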